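/- Let n ≥ 2 be an integer. There exists ε > 0, depending only on n, with the following property. Let σ be a C² map from ℝ^n_+ ∩ B̄₁(0) to the symmetric n×n matrices with |σ(x)| + |Dσ(x)| + |D²σ(x)| < ε for all x, and set g = Id + σ (a C² metric). For i = 1, 2, let y_i ∈ ∂ℝ^n_+ with |y_i| < 1/2, let t_i ∈ [0, 1/2), and let ω_i : [0, t_i] → ℝ^n_+ ∩ B₁(0) be a C² curve solving the geodesic equation ω_i''^k(t) + Σ_{a,b} Γ^k_{ab}(g)(ω_i(t))·ω_i'^a(t)·ω_i'^b(t) = 0 for all t, with ω_i(0) = y_i and ω_i'(0) = ν_g(y_i). If ω₁(t₁) = ω₂(t₂), then y₁ = y₂ and t₁ = t₂. -/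

import Mathlib

open MeasureTheory Real Filter Topology Finset

noncomputable section

/-- Partial derivative of `f` in the `i`-th coordinate direction. -/
def pd {n : ℕ} (i : Fin n) (f : EuclideanSpace ℝ (Fin n) → ℝ)
    (x : EuclideanSpace ℝ (Fin n)) : ℝ :=
  fderiv ℝ f x (EuclideanSpace.single i 1)

/-- The closed upper half-space `{x : x iN ≥ 0}`. -/
def halfSpace {n : ℕ} (iN : Fin n) : Set (EuclideanSpace ℝ (Fin n)) :=
  {x | 0 ≤ x iN}

/-- The boundary hyperplane `{x : x iN = 0}`. -/
def bdry {n : ℕ} (iN : Fin n) : Set (EuclideanSpace ℝ (Fin n)) :=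
  {x | x iN = 0}

/-- Christoffel symbols `Γ^k_{ij}` of a metric `g`. -/
def christoffel {n : ℕ} (g : EuclideanSpace ℝ (Fin n) → Matrix (Fin n) (Fin n) ℝ)
    (k i j : Fin n) (x : EuclideanSpace ℝ (Fin n)) : ℝ :=
  (1 / 2) * ∑ l, (g x)⁻¹ k l *
    (pd i (fun y => g y j l) x + pd j (fun y => g y i l) x - pd l (fun y => g y i j) x)

/-- The Laplace–Beltrami operator of the metric `g`. -/
def laplaceBeltrami {n : ℕ} (g : EuclideanSpace ℝ (Fin n) → Matrix (Fin n) (Fin n) ℝ)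
    (u : EuclideanSpace ℝ (Fin n) → ℝ) (x : EuclideanSpace ℝ (Fin n)) : ℝ :=
  ∑ i, ∑ j, (g x)⁻¹ i j *
    (pd i (pd j u) x - ∑ k, christoffel g k i j x * pd k u x)

/-- The inward-pointing `g`-unit normal to the boundary hyperplane, as a vector. -/
def nuVec {n : ℕ} (iN : Fin n) (g : EuclideanSpace ℝ (Fin n) → Matrix (Fin n) (Fin n) ℝ)
    (y : EuclideanSpace ℝ (Fin n)) : EuclideanSpace ℝ (Fin n) :=
  (WithLp.equiv 2 (Fin n → ℝ)).symm fun i =>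
    (g y)⁻¹ i iN / Real.sqrt ((g y)⁻¹ iN iN)

/-- Normal derivative `D_{ν_g} u` at a boundary point. -/
def nuDeriv {n : ℕ} (iN : Fin n) (g : EuclideanSpace ℝ (Fin n) → Matrix (Fin n) (Fin n) ℝ)
    (u : EuclideanSpace ℝ (Fin n) → ℝ) (y : EuclideanSpace ℝ (Fin n)) : ℝ :=
  ∑ i, nuVec iN g y i * pd i u y

/-- `g` is a `C^m` Riemannian metric on the half-space. -/
def IsCmMetric {n : ℕ} (m : ℕ) (iN : Fin n)
    (g : EuclideanSpace ℝ (Fin n) → Matrix (Fin n) (Fin n) ℝ) : Prop :=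
  (∀ i j, ContDiffOn ℝ m (fun y => g y i j) (halfSpace iN)) ∧
    ∀ x ∈ halfSpace iN, (g x).IsSymm ∧ (g x).PosDef

/-- `g` is `C²`-asymptotically flat of rate `τ` on the half-space. -/
def IsAsymptoticallyFlat {n : ℕ} (iN : Fin n) (τ : ℝ)
    (g : EuclideanSpace ℝ (Fin n) → Matrix (Fin n) (Fin n) ℝ) : Prop :=
  ∃ C₀ > 0, ∀ x ∈ halfSpace iN, 1 ≤ ‖x‖ →
    (∀ i j, |g x i j - (1 : Matrix (Fin n) (Fin n) ℝ) i j| ≤ C₀ * ‖x‖ ^ (-τ)) ∧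
    (∀ i j k, |pd k (fun y => g y i j) x| ≤ C₀ * ‖x‖ ^ (-1 - τ)) ∧
    (∀ i j k l, |pd l (pd k (fun y => g y i j)) x| ≤ C₀ * ‖x‖ ^ (-2 - τ))

/-- The closed upper half-sphere of radius `lam`. -/
def halfSphere {n : ℕ} (iN : Fin n) (lam : ℝ) : Set (EuclideanSpace ℝ (Fin n)) :=
  {x | ‖x‖ = lam ∧ 0 ≤ x iN}

/-- The flux integral `∫_{ℝⁿ₊ ∩ S_λ} Σᵢ xⁱ ∂ᵢu dμ(ḡ)`, with `dμ(ḡ)` the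
`(n-1)`-dimensional Euclidean (Hausdorff) surface measure. -/
def flux {n : ℕ} (iN : Fin n) (u : EuclideanSpace ℝ (Fin n) → ℝ) (lam : ℝ) : ℝ :=
  ∫ x in halfSphere iN lam, (∑ i, x i * pd i u x) ∂(μH[(n : ℝ) - 1])

/-- Euclidean norm of the gradient. -/
def gradNorm {n : ℕ} (u : EuclideanSpace ℝ (Fin n) → ℝ) (x : EuclideanSpace ℝ (Fin n)) : ℝ :=
  Real.sqrt (∑ i, (pd i u x) ^ 2)

/-- Frobenius norm of the Hessian. -/
def hessNorm {n : ℕ} (u : EuclideanSpace ℝ (Fin n) → ℝ) (x : EuclideanSpace ℝ (Fin n)) : ℝ :=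
  Real.sqrt (∑ i, ∑ j, (pd i (pd j u) x) ^ 2)

/-- The Euclidean Laplacian. -/
def euclLap {n : ℕ} (u : EuclideanSpace ℝ (Fin n) → ℝ) (x : EuclideanSpace ℝ (Fin n)) : ℝ :=
  ∑ i, pd i (pd i u) x

/-- The barrier function associated to `τ` and `η`. -/
def barrier {n : ℕ} (iN : Fin n) (τ : ℝ) (η : ℝ → ℝ)
    (x : EuclideanSpace ℝ (Fin n)) : ℝ :=
  -(Real.log ‖x‖)⁻¹ * ‖x‖ ^ ((2 : ℝ) - n) + η (x iN / ‖x‖) * ‖x‖ ^ ((2 : ℝ) - n - τ)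

/-- The Euclidean area of the unit `(n-1)`-sphere in `ℝⁿ`. -/
def sphereArea (n : ℕ) : ℝ :=
  (μH[(n : ℝ) - 1] (Metric.sphere (0 : EuclideanSpace ℝ (Fin n)) 1)).toReal

/-- The quantity whose limit (after normalization) is the half-space mass. -/
def massExpr {n : ℕ} (iN : Fin n)
    (g : EuclideanSpace ℝ (Fin n) → Matrix (Fin n) (Fin n) ℝ) (lam : ℝ) : ℝ :=
  lam⁻¹ *
    ((∫ x in halfSphere iN lam,
        (∑ i, ∑ j, x i * (pd j (fun y => g y i j) x - pd i (fun y => g y j j) x))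
        ∂(μH[(n : ℝ) - 1])) +
      ∫ x in {x : EuclideanSpace ℝ (Fin n) | ‖x‖ = lam ∧ x iN = 0},
        (∑ i ∈ Finset.univ.erase iN, x i * g x i iN) ∂(μH[(n : ℝ) - 2]))

/-- `m` is the half-space (ADM-type) mass of `g`. -/
def HasHalfSpaceMass {n : ℕ} (iN : Fin n)
    (g : EuclideanSpace ℝ (Fin n) → Matrix (Fin n) (Fin n) ℝ) (m : ℝ) : Prop :=
  Filter.Tendsto (fun lam => (2 * ((n : ℝ) - 1) * sphereArea n)⁻¹ * massExpr iN g lam)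
    Filter.atTop (nhds m)

/-- Membership in the weighted Hölder space `C^{2,α}_τ(ℝⁿ₊)`. -/
def MemC2AlphaTau {n : ℕ} (iN : Fin n) (α τ : ℝ)
    (u : EuclideanSpace ℝ (Fin n) → ℝ) : Prop :=
  ContDiffOn ℝ 2 u (halfSpace iN) ∧
  ∃ C₁ > 0,
    (∀ x ∈ halfSpace iN,
      |u x| ≤ C₁ * (1 + ‖x‖) ^ (-τ) ∧
      (∀ i, |pd i u x| ≤ C₁ * (1 + ‖x‖) ^ (-1 - τ)) ∧
      (∀ i j, |pd i (pd j u) x| ≤ C₁ * (1 + ‖x‖) ^ (-2 - τ))) ∧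
    ∀ x₁ ∈ halfSpace iN, ∀ x₂ ∈ halfSpace iN, 1 ≤ ‖x₁‖ → 2 * ‖x₁ - x₂‖ ≤ ‖x₁‖ →
      ∀ i j, |pd i (pd j u) x₁ - pd i (pd j u) x₂| ≤
        C₁ * ‖x₁ - x₂‖ ^ α * ‖x₁‖ ^ (-2 - τ - α)


/-- `ω` (with derivative `ω'` and second derivative `ω''` along `[0, T]`) is a
`g`-geodesic on `[0, T]` staying in `ℝⁿ₊ ∩ B₁(0)`, starting at `y` with initial
velocity the inward `g`-unit normal `ν_g(y)`. -/
def IsNormalGeodesic {n : ℕ} (iN : Fin n)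
    (g : EuclideanSpace ℝ (Fin n) → Matrix (Fin n) (Fin n) ℝ)
    (y : EuclideanSpace ℝ (Fin n)) (T : ℝ)
    (ω ω' ω'' : ℝ → EuclideanSpace ℝ (Fin n)) : Prop :=
  (∀ t ∈ Set.Icc (0 : ℝ) T, HasDerivWithinAt ω (ω' t) (Set.Icc (0 : ℝ) T) t) ∧
  (∀ t ∈ Set.Icc (0 : ℝ) T, HasDerivWithinAt ω' (ω'' t) (Set.Icc (0 : ℝ) T) t) ∧
  (∀ t ∈ Set.Icc (0 : ℝ) T, ω t ∈ halfSpace iN ∩ Metric.ball 0 1) ∧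
  (∀ t ∈ Set.Icc (0 : ℝ) T, ∀ k : Fin n,
    ω'' t k + ∑ a, ∑ b, christoffel g k a b (ω t) * ω' t a * ω' t b = 0) ∧
  ω 0 = y ∧ ω' 0 = nuVec iN g y

theorem contDiff_det_of_entries {V ι : Type*} [NormedAddCommGroup V] [NormedSpace ℝ V]
    [Fintype ι] [DecidableEq ι] {k : WithTop ℕ∞} (A : V → Matrix ι ι ℝ)
    (hA : ∀ i j, ContDiff ℝ k fun x => A x i j) : ContDiff ℝ k fun x => (A x).det := by
  simp only [Matrix.det_apply']
  refine ContDiff.sum fun τ _ => contDiff_const.mul ?_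
  exact contDiff_prod fun i _ => hA _ _

theorem contDiffAt_inv_apply {V ι : Type*} [NormedAddCommGroup V] [NormedSpace ℝ V]
    [Fintype ι] [DecidableEq ι] {k : WithTop ℕ∞} (A : V → Matrix ι ι ℝ)
    (hA : ∀ i j, ContDiff ℝ k fun x => A x i j) {x : V} (hx : (A x).det ≠ 0) (i j : ι) :
    ContDiffAt ℝ k (fun x => (A x)⁻¹ i j) x := by
  have h : (fun x => (A x)⁻¹ i j) = fun x => ((A x).det)⁻¹ * (A x).adjugate i j := by
    funext x
    simp [Matrix.inv_def]
  rw [h]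
  refine ((contDiff_det_of_entries A hA).contDiffAt.inv hx).mul ?_
  simp only [Matrix.adjugate_apply]
  refine (contDiff_det_of_entries _ fun a b => ?_).contDiffAt
  simp only [Matrix.updateRow_apply]
  split_ifs
  · exact contDiff_const
  · exact hA a b

/-- The acceleration prescribed by the geodesic equation of the metric `1 + S` whose entries have
first partial derivatives `P`, at velocity `v`. -/
def geodAcc {n : ℕ} (p : (Fin n → Fin n → ℝ) × (Fin n → Fin n → Fin n → ℝ) ×
    EuclideanSpace ℝ (Fin n)) : EuclideanSpace ℝ (Fin n) :=
  WithLp.toLp 2 fun k => -∑ a, ∑ b, ((1 / 2) * ∑ l, (1 + Matrix.of p.1)⁻¹ k l *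
    (p.2.1 a b l + p.2.1 b a l - p.2.1 l a b)) * p.2.2 a * p.2.2 b

/-- The unit normal to `{x iN = 0}` for the metric `1 + S`. -/
def unitNormal {n : ℕ} (iN : Fin n) (S : Fin n → Fin n → ℝ) : EuclideanSpace ℝ (Fin n) :=
  WithLp.toLp 2 fun i => (1 + Matrix.of S)⁻¹ i iN / Real.sqrt ((1 + Matrix.of S)⁻¹ iN iN)

theorem contDiffAt_geodAcc {n : ℕ} (v : EuclideanSpace ℝ (Fin n)) :
    ContDiffAt ℝ 1 (geodAcc (n := n)) (0, 0, v) := by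
  rw [contDiffAt_euclidean]
  intro k
  simp only [geodAcc]
  have hinv : ∀ l, ContDiffAt ℝ 1 (fun p : (Fin n → Fin n → ℝ) × (Fin n → Fin n → Fin n → ℝ) ×
      EuclideanSpace ℝ (Fin n) => (1 + Matrix.of p.1)⁻¹ k l) (0, 0, v) := fun l => by
    refine contDiffAt_inv_apply (fun p : (Fin n → Fin n → ℝ) × (Fin n → Fin n → Fin n → ℝ) ×
      EuclideanSpace ℝ (Fin n) => 1 + Matrix.of p.1) (fun i j => ?_) ?_ k l
    · simp only [Matrix.add_apply, Matrix.of_apply]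
      fun_prop
    · simp
  have hP : ∀ a b c, ContDiffAt ℝ 1 (fun p : (Fin n → Fin n → ℝ) × (Fin n → Fin n → Fin n → ℝ) ×
      EuclideanSpace ℝ (Fin n) => p.2.1 a b c) (0, 0, v) := fun a b c => by fun_prop
  have hv : ∀ a, ContDiffAt ℝ 1 (fun p : (Fin n → Fin n → ℝ) × (Fin n → Fin n → Fin n → ℝ) ×
      EuclideanSpace ℝ (Fin n) => p.2.2 a) (0, 0, v) := fun a => by fun_prop
  refine ContDiffAt.neg (ContDiffAt.sum fun a _ => ContDiffAt.sum fun b _ => ?_)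
  refine ((contDiffAt_const.mul (ContDiffAt.sum fun l _ => (hinv l).mul ?_)).mul (hv a)).mul (hv b)
  exact ((hP a b l).add (hP b a l)).sub (hP l a b)

theorem contDiffAt_unitNormal {n : ℕ} (iN : Fin n) :
    ContDiffAt ℝ 1 (unitNormal iN) 0 := by
  rw [contDiffAt_euclidean]
  intro i
  simp only [unitNormal]
  have hinv : ∀ k l, ContDiffAt ℝ 1 (fun S : Fin n → Fin n → ℝ => (1 + Matrix.of S)⁻¹ k l) 0 :=
    fun k l => by
      refine contDiffAt_inv_apply (fun S : Fin n → Fin n → ℝ => 1 + Matrix.of S)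
        (fun i j => ?_) ?_ k l
      · simp only [Matrix.add_apply, Matrix.of_apply]
        fun_prop
      · simp
  exact (hinv i iN).div ((hinv iN iN).sqrt (by simp)) (by simp)

theorem geodAcc_smul {n : ℕ} (c : ℝ) (S : Fin n → Fin n → ℝ) (P : Fin n → Fin n → Fin n → ℝ)
    (v : EuclideanSpace ℝ (Fin n)) : geodAcc (S, c • P, v) = c • geodAcc (S, P, v) := by
  ext k
  simp only [geodAcc, PiLp.smul_apply, Pi.smul_apply, smul_eq_mul, mul_neg, Finset.mul_sum,
    Finset.sum_mul]
  congr 1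
  refine Finset.sum_congr rfl fun a _ => Finset.sum_congr rfl fun b _ =>
    Finset.sum_congr rfl fun l _ => ?_
  ring

theorem unitNormal_zero {n : ℕ} (iN : Fin n) :
    unitNormal iN 0 = EuclideanSpace.single iN 1 := by
  ext i
  simp [unitNormal, Matrix.one_apply]

/-- `geodAcc` is small and has small Lipschitz constant when the metric derivatives are small. -/
theorem exists_geodAcc_bounds {n : ℕ} (e : EuclideanSpace ℝ (Fin n)) :
    ∃ L > 0, ∃ r > 0, ∀ ε > 0, ∀ (S S' : Fin n → Fin n → ℝ) (P P' : Fin n → Fin n → Fin n → ℝ)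
      (v v' : EuclideanSpace ℝ (Fin n)), ‖S‖ < r → ‖S'‖ < r → ‖P‖ ≤ ε → ‖P'‖ ≤ ε →
      ‖v - e‖ < r → ‖v' - e‖ < r →
      ‖geodAcc (S, P, v)‖ ≤ L * ε ∧
      ‖geodAcc (S, P, v) - geodAcc (S', P', v')‖ ≤
        L * (ε * ‖S - S'‖ + ‖P - P'‖ + ε * ‖v - v'‖) := by
  obtain ⟨K, t, ht, hK⟩ := (contDiffAt_geodAcc e).exists_lipschitzOnWith
  obtain ⟨r, hr, hball⟩ := Metric.mem_nhds_iff.1 ht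
  have key : ∀ (S S' : Fin n → Fin n → ℝ) (P P' : Fin n → Fin n → Fin n → ℝ)
      (v v' : EuclideanSpace ℝ (Fin n)), ‖S‖ < r → ‖S'‖ < r → ‖P‖ < r → ‖P'‖ < r →
      ‖v - e‖ < r → ‖v' - e‖ < r →
      ‖geodAcc (S, P, v) - geodAcc (S', P', v')‖ ≤ K * (‖S - S'‖ + ‖P - P'‖ + ‖v - v'‖) := by
    intro S S' P P' v v' hS hS' hP hP' hv hv'
    have mem : ∀ (S : Fin n → Fin n → ℝ) (P : Fin n → Fin n → Fin n → ℝ)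
        (v : EuclideanSpace ℝ (Fin n)), ‖S‖ < r → ‖P‖ < r → ‖v - e‖ < r → (S, P, v) ∈ t := by
      intro S P v hS hP hv
      apply hball
      simpa [Prod.dist_eq, dist_eq_norm] using And.intro hS (And.intro hP hv)
    refine (hK.norm_sub_le (mem S P v hS hP hv) (mem S' P' v' hS' hP' hv')).trans ?_
    refine mul_le_mul_of_nonneg_left ?_ K.2
    simp only [Prod.mk_sub_mk, Prod.norm_def]
    have h1 := norm_nonneg (S - S')
    have h2 := norm_nonneg (P - P')
    have h3 := norm_nonneg (v - v')
    exact max_le (by linarith) (max_le (by linarith) (by linarith))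
  have zero : ∀ (S : Fin n → Fin n → ℝ) (v : EuclideanSpace ℝ (Fin n)),
      geodAcc (S, 0, v) = 0 := fun S v => by simpa using geodAcc_smul 0 S 0 v
  -- rescale the derivatives to size `r / 2`
  refine ⟨K * (2 / r) * (r + 1) + 1, by positivity, r, hr, ?_⟩
  intro ε hε S S' P P' v v' hS hS' hP hP' hv hv'
  have scale : ∀ Q : Fin n → Fin n → Fin n → ℝ, ‖Q‖ ≤ ε → ‖(r / (2 * ε)) • Q‖ < r := by
    intro Q hQ
    rw [norm_smul, Real.norm_of_nonneg (by positivity)]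
    calc r / (2 * ε) * ‖Q‖ ≤ r / (2 * ε) * ε := by gcongr
      _ = r / 2 := by field_simp
      _ < r := by linarith
  have back : ∀ (S : Fin n → Fin n → ℝ) (Q : Fin n → Fin n → Fin n → ℝ)
      (v : EuclideanSpace ℝ (Fin n)),
      geodAcc (S, Q, v) = (2 * ε / r) • geodAcc (S, (r / (2 * ε)) • Q, v) := by
    intro S Q v
    rw [← geodAcc_smul, smul_smul, show 2 * ε / r * (r / (2 * ε)) = 1 by field_simp, one_smul]
  have main : ∀ (S S' : Fin n → Fin n → ℝ) (P P' : Fin n → Fin n → Fin n → ℝ)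
      (v v' : EuclideanSpace ℝ (Fin n)), ‖S‖ < r → ‖S'‖ < r → ‖P‖ ≤ ε → ‖P'‖ ≤ ε →
      ‖v - e‖ < r → ‖v' - e‖ < r →
      ‖geodAcc (S, P, v) - geodAcc (S', P', v')‖ ≤
        K * (2 / r) * (ε * ‖S - S'‖ + r / 2 * ‖P - P'‖ + ε * ‖v - v'‖) := by
    intro S S' P P' v v' hS hS' hP hP' hv hv'
    rw [back S P, back S' P', ← smul_sub, norm_smul, Real.norm_of_nonneg (by positivity)]
    have := key S S' _ _ v v' hS hS' (scale P hP) (scale P' hP') hv hv'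
    rw [← smul_sub, norm_smul, Real.norm_of_nonneg (by positivity)] at this
    calc _ ≤ 2 * ε / r * (K * (‖S - S'‖ + r / (2 * ε) * ‖P - P'‖ + ‖v - v'‖)) := by gcongr
      _ = _ := by field_simp
  have hL : (K : ℝ) * (2 / r) * r + K * (2 / r) + 1 = K * (2 / r) * (r + 1) + 1 := by ring
  have hK2 : 0 ≤ (K : ℝ) * (2 / r) := by positivity
  constructor
  · have := main S S P 0 v v hS hS hP (by simpa using hε.le) hv hv
    simp only [zero, sub_zero, sub_self, norm_zero, mul_zero, zero_add, add_zero] at this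
    refine this.trans ?_
    calc (K : ℝ) * (2 / r) * (r / 2 * ‖P‖) ≤ K * (2 / r) * (r / 2 * ε) := by gcongr
      _ = (K * (2 / r) * (r / 2)) * ε := by ring
      _ ≤ _ := by
        gcongr
        nlinarith
  · refine (main S S' P P' v v' hS hS' hP hP' hv hv').trans ?_
    have h1 : 0 ≤ ε * ‖S - S'‖ := by positivity
    have h2 := norm_nonneg (P - P')
    have h3 : 0 ≤ ε * ‖v - v'‖ := by positivity
    calc (K : ℝ) * (2 / r) * (ε * ‖S - S'‖ + r / 2 * ‖P - P'‖ + ε * ‖v - v'‖)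
        ≤ K * (2 / r) * ((r + 1) * (ε * ‖S - S'‖ + ‖P - P'‖ + ε * ‖v - v'‖)) := by
          gcongr
          nlinarith [mul_nonneg hr.le h1, mul_nonneg hr.le h2, mul_nonneg hr.le h3]
      _ ≤ _ := by nlinarith

theorem exists_unitNormal_lipschitz {n : ℕ} (iN : Fin n) :
    ∃ L > 0, ∃ r > 0, ∀ S S' : Fin n → Fin n → ℝ, ‖S‖ < r → ‖S'‖ < r →
      ‖unitNormal iN S - unitNormal iN S'‖ ≤ L * ‖S - S'‖ := by
  obtain ⟨K, t, ht, hK⟩ := (contDiffAt_unitNormal iN).exists_lipschitzOnWith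
  obtain ⟨r, hr, hball⟩ := Metric.mem_nhds_iff.1 ht
  refine ⟨K + 1, by positivity, r, hr, fun S S' hS hS' => ?_⟩
  refine (hK.norm_sub_le (hball (by simpa using hS)) (hball (by simpa using hS'))).trans ?_
  gcongr
  linarith

/-- A second-order Grönwall estimate; nothing is assumed of `u''` at the left endpoint. -/
theorem norm_sub_le_of_norm_deriv2_le {E : Type*} [NormedAddCommGroup E] [NormedSpace ℝ E]
    {T c : ℝ} {u u' u'' : ℝ → E} (hT0 : 0 ≤ T) (hT : T ≤ 1) (hc0 : 0 ≤ c) (hc : c ≤ 1)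
    (hu : ∀ t ∈ Set.Icc 0 T, HasDerivWithinAt u (u' t) (Set.Icc 0 T) t)
    (hu' : ∀ t ∈ Set.Icc 0 T, HasDerivWithinAt u' (u'' t) (Set.Icc 0 T) t)
    (hb : ∀ t ∈ Set.Ioc 0 T, ‖u'' t‖ ≤ c * max ‖u t‖ ‖u' t‖) :
    ‖u T - u 0‖ ≤ ‖u' 0‖ + 3 * c * max ‖u 0‖ ‖u' 0‖ := by
  rcases hT0.eq_or_lt with rfl | hTpos
  · simp only [sub_self, norm_zero]
    positivity
  have key : ∀ s ∈ Set.Ioo 0 T,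
      ‖u T - u s‖ ≤ ‖u' s‖ + 3 * c * max ‖u s‖ ‖u' s‖ := by
    intro s hs
    have hsub : Set.Icc s T ⊆ Set.Icc 0 T := Set.Icc_subset_Icc_left hs.1.le
    have hus : ∀ t ∈ Set.Icc s T, HasDerivWithinAt u (u' t) (Set.Icc s T) t :=
      fun t ht => (hu t (hsub ht)).mono hsub
    have hus' : ∀ t ∈ Set.Icc s T, HasDerivWithinAt u' (u'' t) (Set.Icc s T) t :=
      fun t ht => (hu' t (hsub ht)).mono hsub
    have hbs : ∀ t ∈ Set.Icc s T, ‖u'' t‖ ≤ c * max ‖u t‖ ‖u' t‖ :=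
      fun t ht => hb t ⟨hs.1.trans_le ht.1, ht.2⟩
    have hpair : ∀ t ∈ Set.Icc s T,
        HasDerivWithinAt (fun t => (u t, u' t)) (u' t, u'' t) (Set.Icc s T) t :=
      fun t ht => (hus t ht).prodMk (hus' t ht)
    set M := max ‖u s‖ ‖u' s‖ with hM
    have hM0 : 0 ≤ M := le_max_of_le_left (norm_nonneg _)
    have hgron : ∀ t ∈ Set.Icc s T, max ‖u t‖ ‖u' t‖ ≤ 3 * M := by
      intro t ht
      have := norm_le_gronwallBound_of_norm_deriv_right_le (f := fun t => (u t, u' t))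
        (f' := fun t => (u' t, u'' t)) (δ := M) (K := 1) (ε := 0) (a := s) (b := T)
        (fun t ht => (hpair t ht).continuousWithinAt)
        (fun t ht => ((hpair t (Set.Ico_subset_Icc_self ht)).mono_of_mem_nhdsWithin
          (Icc_mem_nhdsGE_of_mem ht)))
        (by simp [Prod.norm_def, hM])
        (fun t ht => by
          simp only [Prod.norm_def, one_mul, add_zero]
          refine max_le (le_max_right _ _) ((hbs t (Set.Ico_subset_Icc_self ht)).trans ?_)
          exact mul_le_of_le_one_left (le_max_of_le_left (norm_nonneg _)) hc) t ht
      rw [gronwallBound_ε0, Prod.norm_def] at this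
      refine this.trans ?_
      have : Real.exp (1 * (t - s)) ≤ 3 :=
        (Real.exp_le_exp.2 (by linarith [ht.2, hs.1] : 1 * (t - s) ≤ 1)).trans
          (by linarith [Real.exp_one_lt_d9])
      nlinarith
    have hvel : ∀ t ∈ Set.Icc s T, ‖u' t‖ ≤ ‖u' s‖ + 3 * c * M := by
      intro t ht
      have h1 := norm_image_sub_le_of_norm_deriv_le_segment' hus' (C := 3 * c * M)
        (fun x hx => (hbs x (Set.Ico_subset_Icc_self hx)).trans (by
          have := mul_le_mul_of_nonneg_left (hgron x (Set.Ico_subset_Icc_self hx)) hc0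
          linarith)) t ht
      have h2 : ‖u' t‖ ≤ ‖u' s‖ + ‖u' t - u' s‖ := norm_le_insert' _ _
      have h3 : 3 * c * M * (t - s) ≤ 3 * c * M :=
        mul_le_of_le_one_right (by positivity) (by linarith [ht.2, hs.1])
      linarith
    have h1 := norm_image_sub_le_of_norm_deriv_le_segment' hus
      (fun x hx => hvel x (Set.Ico_subset_Icc_self hx)) T ⟨hs.2.le, le_rfl⟩
    exact h1.trans (mul_le_of_le_one_right (by positivity) (by linarith [hs.1]))
  have hcu := (hu 0 ⟨le_rfl, hT0⟩).continuousWithinAt.mono Set.Ioo_subset_Icc_self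
  have hcu' := (hu' 0 ⟨le_rfl, hT0⟩).continuousWithinAt.mono Set.Ioo_subset_Icc_self
  have : (𝓝[Set.Ioo 0 T] (0 : ℝ)).NeBot := by
    rw [nhdsWithin_Ioo_eq_nhdsGT hTpos]
    infer_instance
  refine le_of_tendsto_of_tendsto (tendsto_const_nhds.sub hcu).norm
    (hcu'.norm.add ((hcu.norm.max hcu'.norm).const_mul (3 * c))) ?_
  exact eventually_nhdsWithin_of_forall key

/-- The components of a matrix field at a point, in the sup-normed space of arrays. -/
def fieldVal {n : ℕ} (σ : EuclideanSpace ℝ (Fin n) → Matrix (Fin n) (Fin n) ℝ)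
    (x : EuclideanSpace ℝ (Fin n)) : Fin n → Fin n → ℝ :=
  fun i j => σ x i j

/-- The first partial derivatives of the components of a matrix field. -/
def fieldDeriv {n : ℕ} (σ : EuclideanSpace ℝ (Fin n) → Matrix (Fin n) (Fin n) ℝ)
    (x : EuclideanSpace ℝ (Fin n)) : Fin n → Fin n → Fin n → ℝ :=
  fun k i j => pd k (fun y => σ y i j) x

theorem nuVec_one_add {n : ℕ} (iN : Fin n)
    (σ : EuclideanSpace ℝ (Fin n) → Matrix (Fin n) (Fin n) ℝ) (y : EuclideanSpace ℝ (Fin n)) :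
    nuVec iN (fun x => 1 + σ x) y = unitNormal iN (fieldVal σ y) :=
  rfl

theorem IsNormalGeodesic.accel_eq {n : ℕ} {iN : Fin n}
    {σ : EuclideanSpace ℝ (Fin n) → Matrix (Fin n) (Fin n) ℝ} {y : EuclideanSpace ℝ (Fin n)}
    {T : ℝ} {ω ω' ω'' : ℝ → EuclideanSpace ℝ (Fin n)}
    (h : IsNormalGeodesic iN (fun x => 1 + σ x) y T ω ω' ω'') {t : ℝ} (ht : t ∈ Set.Icc 0 T) :
    ω'' t = geodAcc (fieldVal σ (ω t), fieldDeriv σ (ω t), ω' t) := by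
  ext k
  have hpd : ∀ c i j x, pd c (fun y => (1 + σ y) i j) x = pd c (fun y => σ y i j) x := by
    intro c i j x
    simp only [pd, Matrix.add_apply, fderiv_const_add]
  have := h.2.2.2.1 t ht k
  simp only [christoffel, hpd] at this
  exact eq_neg_of_add_eq_zero_left this

theorem abs_sub_le_of_abs_pd_le {n : ℕ} {f : EuclideanSpace ℝ (Fin n) → ℝ}
    {U : Set (EuclideanSpace ℝ (Fin n))} (hU : Convex ℝ U) {ε : ℝ}
    (hf : ∀ x ∈ U, DifferentiableAt ℝ f x) (hpd : ∀ x ∈ U, ∀ l, |pd l f x| ≤ ε)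
    {x y : EuclideanSpace ℝ (Fin n)} (hx : x ∈ U) (hy : y ∈ U) :
    |f x - f y| ≤ n * ε * ‖x - y‖ := by
  rw [← Real.norm_eq_abs]
  refine Convex.norm_image_sub_le_of_norm_fderiv_le (𝕜 := ℝ) hf (fun z hz => ?_) hU hy hx
  rcases isEmpty_or_nonempty (Fin n) with h | ⟨⟨l₀⟩⟩
  · have : fderiv ℝ f z = 0 := by
      ext w
      simp [Subsingleton.elim w 0]
    rw [this, norm_zero]
    have hn : n = 0 := by
      by_contra h0
      exact h.false ⟨0, Nat.pos_of_ne_zero h0⟩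
    simp [hn]
  have hε : 0 ≤ ε := (abs_nonneg _).trans (hpd z hz l₀)
  refine ContinuousLinearMap.opNorm_le_bound _ (by positivity) fun w => ?_
  have hw : w = ∑ l, w l • EuclideanSpace.single l (1 : ℝ) := by
    ext i
    simp [Pi.single_apply]
  conv_lhs => rw [hw]
  rw [map_sum]
  refine (norm_sum_le _ _).trans ?_
  calc ∑ l, ‖fderiv ℝ f z (w l • EuclideanSpace.single l (1 : ℝ))‖
      ≤ ∑ _l : Fin n, ε * ‖w‖ := by
        refine Finset.sum_le_sum fun l _ => ?_
        rw [map_smul, norm_smul, mul_comm]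
        exact mul_le_mul (hpd z hz l) (PiLp.norm_apply_le w l) (norm_nonneg _) hε
    _ = n * ε * ‖w‖ := by simp [mul_assoc]

/-- The part of the open unit ball strictly above the hyperplane `{x iN = 0}`. -/
def openHalfBall {n : ℕ} (iN : Fin n) : Set (EuclideanSpace ℝ (Fin n)) :=
  {x | 0 < x iN} ∩ Metric.ball 0 1

theorem convex_openHalfBall {n : ℕ} (iN : Fin n) : Convex ℝ (openHalfBall iN) :=
  (convex_halfSpace_gt (EuclideanSpace.proj (𝕜 := ℝ) iN).isLinear 0).inter (convex_ball 0 1)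

theorem isOpen_openHalfBall {n : ℕ} (iN : Fin n) : IsOpen (openHalfBall iN) :=
  (isOpen_lt continuous_const (EuclideanSpace.proj (𝕜 := ℝ) iN).continuous).inter
    Metric.isOpen_ball

theorem openHalfBall_subset {n : ℕ} (iN : Fin n) :
    openHalfBall iN ⊆ halfSpace iN ∩ Metric.closedBall 0 1 :=
  fun x hx => ⟨show 0 ≤ x iN from le_of_lt hx.1, Metric.ball_subset_closedBall hx.2⟩

/-- Bounds on the derivatives over the open half ball give a Lipschitz bound up to the flat part of
the boundary. -/
theorem abs_sub_le_of_contDiffOn {n : ℕ} {iN : Fin n} {f : EuclideanSpace ℝ (Fin n) → ℝ} {ε : ℝ}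
    (hf : ContDiffOn ℝ 2 f (halfSpace iN ∩ Metric.closedBall 0 1))
    (hpd : ∀ x ∈ openHalfBall iN, ∀ l, |pd l f x| ≤ ε)
    {x y : EuclideanSpace ℝ (Fin n)} (hx : x ∈ halfSpace iN ∩ Metric.ball 0 1)
    (hy : y ∈ halfSpace iN ∩ Metric.ball 0 1) : |f x - f y| ≤ n * ε * ‖x - y‖ := by
  have hd : ∀ z ∈ openHalfBall iN, DifferentiableAt ℝ f z := fun z hz =>
    (hf.contDiffAt (mem_of_superset ((isOpen_openHalfBall iN).mem_nhds hz)
      (openHalfBall_subset iN))).differentiableAt (by norm_num)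
  let p : EuclideanSpace ℝ (Fin n) → ℝ → EuclideanSpace ℝ (Fin n) :=
    fun z s => z + s • EuclideanSpace.single iN 1
  have hpc : ∀ z, Tendsto (p z) (𝓝[>] 0) (𝓝 z) := fun z => by
    have : Continuous (p z) := by fun_prop
    simpa [p] using (this.tendsto 0).mono_left nhdsWithin_le_nhds
  have hpU : ∀ z ∈ halfSpace iN ∩ Metric.ball 0 1, ∀ᶠ s in 𝓝[>] (0 : ℝ),
      p z s ∈ openHalfBall iN := fun z hz => by
    filter_upwards [(hpc z).eventually (Metric.isOpen_ball.mem_nhds hz.2),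
      self_mem_nhdsWithin] with s hs hs0
    refine ⟨?_, hs⟩
    have h1 : 0 ≤ z iN := hz.1
    have h2 : 0 < s := hs0
    simp only [p, Set.mem_ofPred_eq, PiLp.add_apply, PiLp.smul_apply, PiLp.single_apply, if_true,
      smul_eq_mul, mul_one]
    linarith
  have hfc : ∀ z ∈ halfSpace iN ∩ Metric.ball 0 1,
      Tendsto (fun s => f (p z s)) (𝓝[>] 0) (𝓝 (f z)) := fun z hz =>
    (hf.continuousOn z ⟨hz.1, Metric.ball_subset_closedBall hz.2⟩).tendsto.comp
      (tendsto_nhdsWithin_iff.2 ⟨hpc z, (hpU z hz).mono fun s hs => openHalfBall_subset iN hs⟩)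
  refine le_of_tendsto_of_tendsto ((hfc x hx).sub (hfc y hy)).abs
    (((hpc x).sub (hpc y)).norm.const_mul (n * ε)) ?_
  filter_upwards [hpU x hx, hpU y hy] with s hs hs'
  exact abs_sub_le_of_abs_pd_le (convex_openHalfBall iN) hd hpd hs hs'

theorem abs_pd_sub_le_of_contDiffOn {n : ℕ} {iN : Fin n} {f : EuclideanSpace ℝ (Fin n) → ℝ}
    {ε : ℝ} (hf : ContDiffOn ℝ 2 f (halfSpace iN ∩ Metric.closedBall 0 1)) (k : Fin n)
    (hpd : ∀ x ∈ openHalfBall iN, ∀ l, |pd l (pd k f) x| ≤ ε)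
    {x y : EuclideanSpace ℝ (Fin n)} (hx : x ∈ openHalfBall iN) (hy : y ∈ openHalfBall iN) :
    |pd k f x - pd k f y| ≤ n * ε * ‖x - y‖ := by
  refine abs_sub_le_of_abs_pd_le (convex_openHalfBall iN) (fun z hz => ?_) hpd hx hy
  have h2 : ContDiffAt ℝ 2 f z := hf.contDiffAt
    (mem_of_superset ((isOpen_openHalfBall iN).mem_nhds hz) (openHalfBall_subset iN))
  exact ((h2.fderiv_right (m := 1) (by norm_num)).differentiableAt (by norm_num)).clm_apply
    (differentiableAt_const _)

/-- A velocity starting near `e` whose derivative is small as long as it is near `e` stays near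
`e`. -/
theorem norm_sub_le_of_local_deriv_bound {E : Type*} [NormedAddCommGroup E] [NormedSpace ℝ E]
    {T a b r : ℝ} {e : E} {v v' : ℝ → E} (hT : T ≤ 1) (hb : 0 < b) (hr : a + 2 * b < r)
    (hv : ∀ t ∈ Set.Icc 0 T, HasDerivWithinAt v (v' t) (Set.Icc 0 T) t) (h0 : ‖v 0 - e‖ ≤ a)
    (hloc : ∀ t ∈ Set.Icc 0 T, ‖v t - e‖ < r → ‖v' t‖ ≤ b) :
    ∀ t ∈ Set.Icc 0 T, ‖v t - e‖ ≤ a + 2 * b := by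
  intro t ht
  have := image_norm_le_of_norm_deriv_right_lt_deriv_boundary (f := fun t => v t - e) (f' := v')
    (a := 0) (b := T) (B := fun t => a + 2 * b * t) (B' := fun _ => 2 * b)
    (fun t ht => ((hv t ht).sub_const e).continuousWithinAt)
    (fun t ht => ((hv t (Set.Ico_subset_Icc_self ht)).sub_const e).mono_of_mem_nhdsWithin
      (Icc_mem_nhdsGE_of_mem ht))
    (by simpa using h0)
    (fun t => by simpa using ((hasDerivAt_id t).const_mul (2 * b)).const_add a)
    (fun t ht heq => by
      have h1 : 2 * b * t ≤ 2 * b := mul_le_of_le_one_right (by positivity) (by linarith [ht.2])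
      have := hloc t (Set.Ico_subset_Icc_self ht) (by rw [heq]; linarith)
      linarith) ht
  have h1 : 2 * b * t ≤ 2 * b := mul_le_of_le_one_right (by positivity) (by linarith [ht.2])
  linarith

theorem norm_sub_sub_smul_le {E : Type*} [NormedAddCommGroup E] [NormedSpace ℝ E]
    {T c : ℝ} {e : E} {u u' : ℝ → E}
    (hu : ∀ t ∈ Set.Icc 0 T, HasDerivWithinAt u (u' t) (Set.Icc 0 T) t)
    (hc : ∀ t ∈ Set.Icc 0 T, ‖u' t - e‖ ≤ c) {s t : ℝ} (hs : 0 ≤ s) (hst : s ≤ t) (ht : t ≤ T) :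
    ‖u t - u s - (t - s) • e‖ ≤ c * (t - s) := by
  have hsub : Set.Icc s t ⊆ Set.Icc 0 T := Set.Icc_subset_Icc hs ht
  have := norm_image_sub_le_of_norm_deriv_le_segment' (f := fun x => u x - x • e)
    (f' := fun x => u' x - e) (a := s) (b := t) (C := c)
    (fun x hx => by
      simpa only [one_smul, id_eq] using
        ((hu x (hsub hx)).mono hsub).fun_sub ((hasDerivWithinAt_id x _).smul_const e))
    (fun x hx => hc x (hsub (Set.Ico_subset_Icc_self hx))) t ⟨hst, le_rfl⟩
  refine le_of_eq_of_le ?_ this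
  congr 1
  module

/-- The components of `σ` and their first and second derivatives are smaller than `ε`. -/
def IsSmallField {n : ℕ} (iN : Fin n) (ε : ℝ)
    (σ : EuclideanSpace ℝ (Fin n) → Matrix (Fin n) (Fin n) ℝ) : Prop :=
  (∀ i j, ContDiffOn ℝ 2 (fun y => σ y i j) (halfSpace iN ∩ Metric.closedBall 0 1)) ∧
    ∀ x ∈ halfSpace iN ∩ Metric.closedBall 0 1,
      (∀ i j, |σ x i j| < ε) ∧
      (∀ i j k, |pd k (fun y => σ y i j) x| < ε) ∧
      (∀ i j k l, |pd l (pd k (fun y => σ y i j)) x| < ε)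

namespace IsSmallField

variable {n : ℕ} {iN : Fin n} {ε : ℝ} {σ : EuclideanSpace ℝ (Fin n) → Matrix (Fin n) (Fin n) ℝ}
  {x y : EuclideanSpace ℝ (Fin n)}

theorem norm_fieldVal_le (h : IsSmallField iN ε σ) (hε : 0 ≤ ε)
    (hx : x ∈ halfSpace iN ∩ Metric.ball 0 1) : ‖fieldVal σ x‖ ≤ ε := by
  have hx' := (h.2 x ⟨hx.1, Metric.ball_subset_closedBall hx.2⟩).1
  exact (pi_norm_le_iff_of_nonneg hε).2 fun i => (pi_norm_le_iff_of_nonneg hε).2 fun j =>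
    (hx' i j).le

theorem norm_fieldDeriv_le (h : IsSmallField iN ε σ) (hε : 0 ≤ ε)
    (hx : x ∈ halfSpace iN ∩ Metric.ball 0 1) : ‖fieldDeriv σ x‖ ≤ ε := by
  have hx' := (h.2 x ⟨hx.1, Metric.ball_subset_closedBall hx.2⟩).2.1
  exact (pi_norm_le_iff_of_nonneg hε).2 fun k => (pi_norm_le_iff_of_nonneg hε).2 fun i =>
    (pi_norm_le_iff_of_nonneg hε).2 fun j => (hx' i j k).le

theorem norm_fieldVal_sub_le (h : IsSmallField iN ε σ) (hε : 0 ≤ ε)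
    (hx : x ∈ halfSpace iN ∩ Metric.ball 0 1) (hy : y ∈ halfSpace iN ∩ Metric.ball 0 1) :
    ‖fieldVal σ x - fieldVal σ y‖ ≤ n * ε * ‖x - y‖ := by
  have h0 : 0 ≤ n * ε * ‖x - y‖ := by positivity
  exact (pi_norm_le_iff_of_nonneg h0).2 fun i => (pi_norm_le_iff_of_nonneg h0).2 fun j =>
    abs_sub_le_of_contDiffOn (h.1 i j)
      (fun z hz l => ((h.2 z (openHalfBall_subset iN hz)).2.1 i j l).le) hx hy

theorem norm_fieldDeriv_sub_le (h : IsSmallField iN ε σ) (hε : 0 ≤ ε)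
    (hx : x ∈ openHalfBall iN) (hy : y ∈ openHalfBall iN) :
    ‖fieldDeriv σ x - fieldDeriv σ y‖ ≤ n * ε * ‖x - y‖ := by
  have h0 : 0 ≤ n * ε * ‖x - y‖ := by positivity
  exact (pi_norm_le_iff_of_nonneg h0).2 fun k => (pi_norm_le_iff_of_nonneg h0).2 fun i =>
    (pi_norm_le_iff_of_nonneg h0).2 fun j => abs_pd_sub_le_of_contDiffOn (h.1 i j) k
      (fun z hz l => ((h.2 z (openHalfBall_subset iN hz)).2.2 i j k l).le) hx hy

end IsSmallField

theorem exists_normalGeodesic_endpoint_injective {n : ℕ} (iN : Fin n) :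
    ∃ ε > 0, ∀ σ : EuclideanSpace ℝ (Fin n) → Matrix (Fin n) (Fin n) ℝ, IsSmallField iN ε σ →
      ∀ (y₁ y₂ : EuclideanSpace ℝ (Fin n)) (t₁ t₂ : ℝ)
        (ω₁ ω₁' ω₁'' ω₂ ω₂' ω₂'' : ℝ → EuclideanSpace ℝ (Fin n)),
        y₁ ∈ bdry iN → y₂ ∈ bdry iN → 0 ≤ t₁ → t₁ ≤ t₂ → t₂ ≤ 1 →
        IsNormalGeodesic iN (fun x => 1 + σ x) y₁ t₁ ω₁ ω₁' ω₁'' →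
        IsNormalGeodesic iN (fun x => 1 + σ x) y₂ t₂ ω₂ ω₂' ω₂'' →
        ω₁ t₁ = ω₂ t₂ → y₁ = y₂ ∧ t₁ = t₂ := by
  set e : EuclideanSpace ℝ (Fin n) := EuclideanSpace.single iN 1 with he
  have heN : e iN = 1 := by simp [he]
  have hen : ‖e‖ = 1 := by simp [he]
  obtain ⟨L₁, hL₁, r₁, hr₁, hF⟩ := exists_geodAcc_bounds e
  obtain ⟨L₂, hL₂, r₂, hr₂, hG⟩ := exists_unitNormal_lipschitz iN
  obtain ⟨A, hA⟩ : ∃ A, A = L₂ + 2 * L₁ := ⟨_, rfl⟩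
  obtain ⟨B, hB⟩ : ∃ B, B = L₂ * n + 3 * (L₁ * (2 * n + 1)) := ⟨_, rfl⟩
  have hA0 : 0 < A := by rw [hA]; positivity
  have hB0 : 0 ≤ B := by rw [hB]; positivity
  obtain ⟨m, hm⟩ : ∃ m, m = min 1 (min r₁ r₂) / 2 := ⟨_, rfl⟩
  have hm0 : 0 < m := by rw [hm]; positivity
  have hm1 : m < 1 := by linarith [min_le_left 1 (min r₁ r₂)]
  have hmr₁ : m < r₁ := by linarith [min_le_right 1 (min r₁ r₂), min_le_left r₁ r₂]
  have hmr₂ : m < r₂ := by linarith [min_le_right 1 (min r₁ r₂), min_le_right r₁ r₂]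
  obtain ⟨ε, hεdef⟩ : ∃ ε, ε = m / (1 + A + 2 * B) := ⟨_, rfl⟩
  have hε : 0 < ε := by rw [hεdef]; positivity
  have hεm : ε + A * ε + 2 * (B * ε) = m := by rw [hεdef]; field_simp
  have hAε : 0 < A * ε := by positivity
  have hBε : 0 ≤ B * ε := by positivity
  refine ⟨ε, hε, fun σ hσ y₁ y₂ t₁ t₂ ω₁ ω₁' ω₁'' ω₂ ω₂' ω₂'' hy₁ hy₂ ht₁ h12 ht₂ h₁ h₂ heq => ?_⟩
  have hval : ∀ x ∈ halfSpace iN ∩ Metric.ball 0 1, ‖fieldVal σ x‖ ≤ ε :=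
    fun x hx => hσ.norm_fieldVal_le hε.le hx
  have hder : ∀ x ∈ halfSpace iN ∩ Metric.ball 0 1, ‖fieldDeriv σ x‖ ≤ ε :=
    fun x hx => hσ.norm_fieldDeriv_le hε.le hx
  have hvel : ∀ {y : EuclideanSpace ℝ (Fin n)} {T : ℝ}
      {ω ω' ω'' : ℝ → EuclideanSpace ℝ (Fin n)}, 0 ≤ T → T ≤ 1 →
      IsNormalGeodesic iN (fun x => 1 + σ x) y T ω ω' ω'' →
      ∀ t ∈ Set.Icc 0 T, ‖ω' t - e‖ ≤ A * ε := by
    intro y T ω ω' ω'' hT0 hT h t ht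
    have hy := h.2.2.1 0 ⟨le_rfl, hT0⟩
    rw [h.2.2.2.2.1] at hy
    have := norm_sub_le_of_local_deriv_bound (a := L₂ * ε) (b := L₁ * ε) (r := r₁) (e := e) hT
      (by positivity) (by
        have : L₂ * ε + 2 * (L₁ * ε) = A * ε := by rw [hA]; ring
        linarith) h.2.1 (by
        rw [h.2.2.2.2.2, nuVec_one_add, he, ← unitNormal_zero iN]
        refine (hG _ _ (by linarith [hval y hy]) (by simpa using hr₂)).trans ?_
        rw [sub_zero]
        gcongr
        exact hval y hy) (fun s hs hse => by
        rw [h.accel_eq hs]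
        have hin := h.2.2.1 s hs
        have hlt : ‖fieldVal σ (ω s)‖ < r₁ := by linarith [hval _ hin]
        exact (hF ε hε _ _ _ _ _ _ hlt hlt (hder _ hin) (hder _ hin) hse hse).1) t ht
    refine this.trans_eq ?_
    rw [hA]
    ring
  have hpos : ∀ {y : EuclideanSpace ℝ (Fin n)} {T : ℝ}
      {ω ω' ω'' : ℝ → EuclideanSpace ℝ (Fin n)}, T ≤ 1 → y ∈ bdry iN →
      IsNormalGeodesic iN (fun x => 1 + σ x) y T ω ω' ω'' →
      ∀ t ∈ Set.Ioc 0 T, ω t ∈ openHalfBall iN := by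
    intro y T ω ω' ω'' hT hy h t ht
    refine ⟨?_, (h.2.2.1 t (Set.Ioc_subset_Icc_self ht)).2⟩
    have hT0 : 0 ≤ T := ht.1.le.trans ht.2
    have h1 := (PiLp.norm_apply_le _ iN).trans
      (norm_sub_sub_smul_le h.1 (hvel hT0 hT h) le_rfl ht.1.le ht.2)
    have hy0 : y iN = 0 := hy
    simp only [h.2.2.2.2.1, PiLp.sub_apply, PiLp.smul_apply, heN, hy0, sub_zero, smul_eq_mul,
      mul_one, Real.norm_eq_abs] at h1
    have h2 := (abs_le.1 h1).1
    have h3 : A * ε * t < t := mul_lt_of_lt_one_left ht.1 (by linarith)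
    show 0 < ω t iN
    linarith
  have hsub₂ : Set.Icc 0 t₁ ⊆ Set.Icc 0 t₂ := Set.Icc_subset_Icc_right h12
  have hy₁' := h₁.2.2.1 0 ⟨le_rfl, ht₁⟩
  have hy₂' := h₂.2.2.1 0 ⟨le_rfl, ht₁.trans h12⟩
  rw [h₁.2.2.2.2.1] at hy₁'
  rw [h₂.2.2.2.2.1] at hy₂'
  have hinit : ‖ω₁' 0 - ω₂' 0‖ ≤ L₂ * n * ε * ‖y₁ - y₂‖ := by
    rw [h₁.2.2.2.2.2, h₂.2.2.2.2.2, nuVec_one_add, nuVec_one_add]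
    refine (hG _ _ (by linarith [hval _ hy₁']) (by linarith [hval _ hy₂'])).trans ?_
    have := mul_le_mul_of_nonneg_left (hσ.norm_fieldVal_sub_le hε.le hy₁' hy₂') hL₂.le
    linarith
  obtain ⟨c, hc⟩ : ∃ c, c = L₁ * (2 * n + 1) * ε := ⟨_, rfl⟩
  have hc0 : 0 ≤ c := by rw [hc]; positivity
  have hνB : L₂ * n * ε + 3 * c = B * ε := by rw [hB, hc]; ring
  have hν0 : 0 ≤ L₂ * n * ε := by positivity
  have hgron := norm_sub_le_of_norm_deriv2_le (u := fun t => ω₁ t - ω₂ t)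
    (u' := fun t => ω₁' t - ω₂' t) (u'' := fun t => ω₁'' t - ω₂'' t) ht₁ (h12.trans ht₂) hc0
    (by linarith)
    (fun t ht => (h₁.1 t ht).fun_sub ((h₂.1 t (hsub₂ ht)).mono hsub₂))
    (fun t ht => (h₁.2.1 t ht).fun_sub ((h₂.2.1 t (hsub₂ ht)).mono hsub₂))
    (fun t ht => by
      have ht1 := Set.Ioc_subset_Icc_self ht
      have ht2 := hsub₂ ht1
      have in1 := h₁.2.2.1 t ht1
      have in2 := h₂.2.2.1 t ht2
      have hU1 := hpos (h12.trans ht₂) hy₁ h₁ t ht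
      have hU2 := hpos ht₂ hy₂ h₂ t ⟨ht.1, ht.2.trans h12⟩
      have hv1 := hvel ht₁ (h12.trans ht₂) h₁ t ht1
      have hv2 := hvel (ht₁.trans h12) ht₂ h₂ t ht2
      rw [h₁.accel_eq ht1, h₂.accel_eq ht2]
      refine (hF ε hε _ _ _ _ _ _ (by linarith [hval _ in1]) (by linarith [hval _ in2])
        (hder _ in1) (hder _ in2) (by linarith) (by linarith)).2.trans ?_
      have hS := hσ.norm_fieldVal_sub_le hε.le in1 in2
      have hP := hσ.norm_fieldDeriv_sub_le hε.le hU1 hU2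
      set M := max ‖ω₁ t - ω₂ t‖ ‖ω₁' t - ω₂' t‖ with hM
      have hM1 : ‖ω₁ t - ω₂ t‖ ≤ M := le_max_left _ _
      have hM2 : ‖ω₁' t - ω₂' t‖ ≤ M := le_max_right _ _
      have hM0 : 0 ≤ M := (norm_nonneg _).trans hM1
      have hx : n * ε * ‖ω₁ t - ω₂ t‖ ≤ n * ε * M := by gcongr
      have hS' : ε * ‖fieldVal σ (ω₁ t) - fieldVal σ (ω₂ t)‖ ≤ n * ε * M :=
        (mul_le_of_le_one_left (norm_nonneg _) (by linarith)).trans (hS.trans hx)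
      calc _ ≤ L₁ * (n * ε * M + n * ε * M + ε * M) := by
            gcongr
            exact hP.trans hx
        _ = c * M := by rw [hc]; ring)
  simp only [h₁.2.2.2.2.1, h₂.2.2.2.2.1] at hgron
  set w := y₁ - y₂ with hw
  have hmax : max ‖w‖ ‖ω₁' 0 - ω₂' 0‖ = ‖w‖ :=
    max_eq_left (hinit.trans (mul_le_of_le_one_left (norm_nonneg _) (by linarith)))
  rw [hmax, heq] at hgron
  have hd : ‖ω₂ t₂ - ω₂ t₁ - w‖ ≤ B * ε * ‖w‖ := by
    rw [← hνB]
    linarith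
  have hτ : ‖ω₂ t₂ - ω₂ t₁ - (t₂ - t₁) • e‖ ≤ A * ε * (t₂ - t₁) :=
    norm_sub_sub_smul_le h₂.1 (hvel (ht₁.trans h12) ht₂ h₂) ht₁ h12 le_rfl
  have hN : ‖w - (t₂ - t₁) • e‖ ≤ A * ε * (t₂ - t₁) + B * ε * ‖w‖ := by
    have h := norm_sub_le (ω₂ t₂ - ω₂ t₁ - (t₂ - t₁) • e) (ω₂ t₂ - ω₂ t₁ - w)
    rw [sub_sub_sub_cancel_left] at h
    linarith
  have hwN : w iN = 0 := by
    have e1 : y₁ iN = 0 := hy₁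
    have e2 : y₂ iN = 0 := hy₂
    simp [hw, e1, e2]
  have hτN : t₂ - t₁ ≤ ‖w - (t₂ - t₁) • e‖ := by
    have h := PiLp.norm_apply_le (w - (t₂ - t₁) • e) iN
    simp only [PiLp.sub_apply, PiLp.smul_apply, heN, hwN, smul_eq_mul, mul_one, zero_sub,
      norm_neg, Real.norm_eq_abs] at h
    exact (le_abs_self _).trans h
  have hwle : ‖w‖ ≤ ‖w - (t₂ - t₁) • e‖ + (t₂ - t₁) := by
    have h := norm_add_le (w - (t₂ - t₁) • e) ((t₂ - t₁) • e)
    rwa [sub_add_cancel, norm_smul, hen, mul_one, Real.norm_of_nonneg (by linarith)] at h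
  have hzero : ‖w - (t₂ - t₁) • e‖ ≤ 0 := by
    have b1 := mul_le_mul_of_nonneg_left hτN hAε.le
    have b2 : B * ε * ‖w‖ ≤ B * ε * (2 * ‖w - (t₂ - t₁) • e‖) :=
      mul_le_mul_of_nonneg_left (by linarith) hBε
    have b3 : 0 < 1 - A * ε - 2 * (B * ε) := by linarith
    nlinarith
  have hτ0 : t₁ = t₂ := by linarith
  have hw0 : ‖w‖ ≤ 0 := by linarith
  exact ⟨sub_eq_zero.1 (norm_le_zero_iff.1 hw0), hτ0⟩

/-- injectivity of the normal exponential map of the boundary for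
metrics `C²`-close to the Euclidean metric. -/
theorem stmt11 (n : ℕ) (hn : 2 ≤ n) (iN : Fin n) (hiN : (iN : ℕ) = n - 1) :
    ∃ ε > (0 : ℝ), ∀ σ : EuclideanSpace ℝ (Fin n) → Matrix (Fin n) (Fin n) ℝ,
      (∀ i j, ContDiffOn ℝ 2 (fun y => σ y i j)
        (halfSpace iN ∩ Metric.closedBall 0 1)) →
      (∀ x ∈ halfSpace iN ∩ Metric.closedBall 0 1, (σ x).IsSymm) →
      (∀ x ∈ halfSpace iN ∩ Metric.closedBall 0 1,
        (∀ i j, |σ x i j| < ε) ∧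
        (∀ i j k, |pd k (fun y => σ y i j) x| < ε) ∧
        (∀ i j k l, |pd l (pd k (fun y => σ y i j)) x| < ε)) →
      ∀ (y₁ y₂ : EuclideanSpace ℝ (Fin n)) (t₁ t₂ : ℝ)
        (ω₁ ω₁' ω₁'' ω₂ ω₂' ω₂'' : ℝ → EuclideanSpace ℝ (Fin n)),
        y₁ ∈ bdry iN → ‖y₁‖ < 1 / 2 → y₂ ∈ bdry iN → ‖y₂‖ < 1 / 2 →
        0 ≤ t₁ → t₁ < 1 / 2 → 0 ≤ t₂ → t₂ < 1 / 2 →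
        IsNormalGeodesic iN (fun x => 1 + σ x) y₁ t₁ ω₁ ω₁' ω₁'' →
        IsNormalGeodesic iN (fun x => 1 + σ x) y₂ t₂ ω₂ ω₂' ω₂'' →
        ω₁ t₁ = ω₂ t₂ → y₁ = y₂ ∧ t₁ = t₂ := by
  obtain ⟨ε, hε, H⟩ := exists_normalGeodesic_endpoint_injective iN
  refine ⟨ε, hε, fun σ hσ _ hb y₁ y₂ t₁ t₂ ω₁ ω₁' ω₁'' ω₂ ω₂' ω₂'' hy₁ _ hy₂ _ ht₁ ht₁' ht₂ ht₂'
    h₁ h₂ heq => ?_⟩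
  rcases le_total t₁ t₂ with h | h
  · exact H σ ⟨hσ, hb⟩ y₁ y₂ t₁ t₂ _ _ _ _ _ _ hy₁ hy₂ ht₁ h (by linarith) h₁ h₂ heq
  · have := H σ ⟨hσ, hb⟩ y₂ y₁ t₂ t₁ _ _ _ _ _ _ hy₂ hy₁ ht₂ h (by linarith) h₂ h₁ heq.symm
    exact ⟨this.1.symm, this.2.symm⟩

end
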